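/- arXiv:1405.3529 — 2 statements merged into one kernel-verified Lean document; each statement's English description precedes it below -/
import Mathlib

section
/- Let T be a linear involution. For every point z ∈ Î∖Ô, the infinite natural coding Σ_T(z) is a reduced infinite word over A ∪ A⁻¹, i.e. it contains no factor of the form a a⁻¹ with a ∈ A ∪ A⁻¹. -/
open Set

namespace LinInv

/-- A letter of the extended alphabet `A ∪ A⁻¹`, encoded as a pair of a letter
of `A` and a sign. -/
abbrev Letter (A : Type*) := A × Bool

/-- The formal inverse of a letter. -/
def Letter.inv {A : Type*} (c : Letter A) : Letter A := (c.1, !c.2)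

/-- The inverse of a word over `A ∪ A⁻¹`. -/
def wordInv {A : Type*} (u : List (Letter A)) : List (Letter A) :=
  (u.map Letter.inv).reverse

/-- The involution `σ₂` exchanging the two components of `Î = I × {0,1}`. -/
def s2 (z : ℝ × Bool) : ℝ × Bool := (z.1, !z.2)

/-- A linear involution on the alphabet `A`: the open interval `I = ]lo,hi[`,
for each `c ∈ A ∪ A⁻¹` an open subinterval `I_c = ]endLo c, endHi c[ × {comp c}`
of one of the two components of `Î = I × {0,1}`, the finite set `Sig` of division
points, and the first involution `σ₁`, subject to the defining conditions. -/
structure LinearInvolution (A : Type*) [Fintype A] where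
  lo : ℝ
  hi : ℝ
  lo_lt_hi : lo < hi
  endLo : Letter A → ℝ
  endHi : Letter A → ℝ
  end_lt : ∀ c, endLo c < endHi c
  comp : Letter A → Bool
  sub_lo : ∀ c, lo ≤ endLo c
  sub_hi : ∀ c, endHi c ≤ hi
  /-- the length data satisfy `λ_a = λ_{a⁻¹}` -/
  len_inv : ∀ c, endHi c - endLo c = endHi (Letter.inv c) - endLo (Letter.inv c)
  /-- the set of division points -/
  Sig : Set (ℝ × Bool)
  Sig_sub : Sig ⊆ Ioo lo hi ×ˢ (univ : Set Bool)
  /-- there are `2k-2` division points -/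
  Sig_card : Sig.ncard = 2 * Fintype.card A - 2
  /-- the intervals `I_c` are pairwise disjoint -/
  disj : ∀ c d : Letter A, c ≠ d →
    Disjoint (Ioo (endLo c) (endHi c) ×ˢ ({comp c} : Set Bool))
      (Ioo (endLo d) (endHi d) ×ˢ ({comp d} : Set Bool))
  Sig_disj : ∀ c : Letter A,
    Disjoint Sig (Ioo (endLo c) (endHi c) ×ˢ ({comp c} : Set Bool))
  /-- the intervals `I_c` partition `Î` minus the division points -/
  cover : Ioo lo hi ×ˢ (univ : Set Bool) =
    (⋃ c : Letter A, Ioo (endLo c) (endHi c) ×ˢ ({comp c} : Set Bool)) ∪ Sig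
  /-- the first involution `σ₁` (as a total map; only its values on `Î ∖ Σ` matter) -/
  s1 : ℝ × Bool → ℝ × Bool
  s1_invol : ∀ z ∈ (Ioo lo hi ×ˢ (univ : Set Bool)) \ Sig, s1 (s1 z) = z
  /-- on each `I_c`, `σ₁` is either a translation or a symmetry -/
  s1_iso : ∀ c : Letter A,
    (∃ α : ℝ, ∀ z ∈ Ioo (endLo c) (endHi c) ×ˢ ({comp c} : Set Bool),
        s1 z = (z.1 + α, comp (Letter.inv c))) ∨
    (∃ α : ℝ, ∀ z ∈ Ioo (endLo c) (endHi c) ×ˢ ({comp c} : Set Bool),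
        s1 z = (-z.1 + α, comp (Letter.inv c)))
  /-- `σ₁` maps `I_c` onto `I_{c⁻¹}` -/
  s1_image : ∀ c : Letter A,
    s1 '' (Ioo (endLo c) (endHi c) ×ˢ ({comp c} : Set Bool)) =
      Ioo (endLo (Letter.inv c)) (endHi (Letter.inv c)) ×ˢ
        ({comp (Letter.inv c)} : Set Bool)

namespace LinearInvolution

variable {A : Type*} [Fintype A] (L : LinearInvolution A)

/-- The domain `Î = I × {0,1}`. -/
def Ihat : Set (ℝ × Bool) := Ioo L.lo L.hi ×ˢ (univ : Set Bool)

/-- The interval `I_c` associated with the letter `c ∈ A ∪ A⁻¹`. -/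
def Ia (c : Letter A) : Set (ℝ × Bool) :=
  Ioo (L.endLo c) (L.endHi c) ×ˢ ({L.comp c} : Set Bool)

/-- The linear involution `T = σ₂ ∘ σ₁`. -/
def T (z : ℝ × Bool) : ℝ × Bool := s2 (L.s1 z)

/-- `O = ⋃_{n ≥ 0} T⁻ⁿ(Σ)`, the negative orbit of the singular points. -/
def O : Set (ℝ × Bool) := ⋃ n : ℕ, (L.T)^[n] ⁻¹' L.Sig

/-- `Ô = O ∪ σ₂(O)`. -/
def Ohat : Set (ℝ × Bool) := L.O ∪ s2 '' L.O

/-- `T` has a connection if some singularity `x` of `T⁻¹` reaches a singularity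
`y` of `T` in `n ≥ 0` steps. -/
def HasConnection : Prop := ∃ x ∈ s2 '' L.Sig, ∃ n : ℕ, (L.T)^[n] x ∈ L.Sig

/-- `T` is nonorientable if some `I_c` and `I_{c⁻¹}` lie in the same component. -/
def Nonorientable : Prop := ∃ c : Letter A, L.comp c = L.comp (Letter.inv c)

/-- `T` is orientable if it is not nonorientable. -/
def Orientable : Prop := ¬ L.Nonorientable

/-- `u` occurs in the natural coding of the orbit of `z` at position `m`. -/
def IsCodingFrom (z : ℝ × Bool) (m : ℕ) (u : List (Letter A)) : Prop :=
  ∀ i : Fin u.length, (L.T)^[m + i.1] z ∈ L.Ia (u.get i)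

/-- The natural coding `L(T)`: the set of factors of the infinite natural
codings `Σ_T(z)` for `z ∈ Î ∖ Ô`. -/
def lang : Set (List (Letter A)) :=
  {u | ∃ z ∈ L.Ihat \ L.Ohat, ∃ m : ℕ, L.IsCodingFrom z m u}

/-- The interval `I_w = I_{a₀} ∩ T⁻¹(I_{a₁}) ∩ ⋯ ∩ T^{-m+1}(I_{a_{m-1}})`
associated with a word `w = a₀a₁⋯a_{m-1}`; by convention `I_ε = Î`. -/
def Iw (u : List (Letter A)) : Set (ℝ × Bool) :=
  L.Ihat ∩ ⋂ i : Fin u.length, (L.T)^[i.1] ⁻¹' L.Ia (u.get i)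

/-- The return time `ρ_X(x) = inf {n ≥ 1 ∣ Tⁿ(x) ∈ X}`, with value `∞` if the
orbit of `x` never returns to `X`. -/
noncomputable def retTime (X : Set (ℝ × Bool)) (x : ℝ × Bool) : ℕ∞ :=
  sInf {n : ℕ∞ | ∃ m : ℕ, n = (m : ℕ∞) ∧ 1 ≤ m ∧ (L.T)^[m] x ∈ X}

/-- A word is even if it has an even number of odd letters (a letter `a` is odd
when `I_a` and `I_{a⁻¹}` lie in the same component). -/
def EvenWord (u : List (Letter A)) : Prop :=
  Even (u.countP fun c => L.comp (c.1, true) == L.comp (c.1, false))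

/-- The morphism `F_A → ℤ/2ℤ` sending each odd letter to `1` and each even
letter to `0`. -/
noncomputable def evenHom : FreeGroup A →* Multiplicative (ZMod 2) :=
  FreeGroup.lift fun a =>
    Multiplicative.ofAdd (if L.comp (a, true) = L.comp (a, false) then (1 : ZMod 2) else 0)

/-- The even group: the subgroup of `F_A` formed by the even elements. -/
noncomputable def evenGroup : Subgroup (FreeGroup A) := (L.evenHom).ker

/-- The admissibility condition at an endpoint `x` of an interval `J`:
either `x = Tⁿ(z)` for a singularity `z` of `T⁻¹` with `T^k(z) ∉ J` for
`0 ≤ k ≤ n`, or `Tⁿ(x) = z` for a singularity `z` of `T` with `T^k(x) ∉ J`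
for `0 ≤ k ≤ n`. -/
def AdmissibleEndpoint (J : Set (ℝ × Bool)) (x : ℝ × Bool) : Prop :=
  (∃ z ∈ s2 '' L.Sig, ∃ n : ℕ, (L.T)^[n] z = x ∧ ∀ k ≤ n, (L.T)^[k] z ∉ J) ∨
  (∃ z ∈ L.Sig, ∃ n : ℕ, (L.T)^[n] x = z ∧ ∀ k ≤ n, (L.T)^[k] x ∉ J)

/-- The open interval `]u,v[ × {δ}` is admissible with respect to `T`. -/
def AdmissibleInterval (u v : ℝ) (δ : Bool) : Prop :=
  u < v ∧ L.AdmissibleEndpoint (Ioo u v ×ˢ ({δ} : Set Bool)) (u, δ) ∧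
    L.AdmissibleEndpoint (Ioo u v ×ˢ ({δ} : Set Bool)) (v, δ)

end LinearInvolution

/-- A set of words is factorial if it contains the factors of its elements. -/
def FactorialSet {α : Type*} (S : Set (List α)) : Prop :=
  ∀ u ∈ S, ∀ v : List α, v <:+: u → v ∈ S

/-- A word over `A ∪ A⁻¹` is reduced if it has no factor `c c⁻¹`. -/
def Reduced {A : Type*} (u : List (Letter A)) : Prop :=
  u.Chain' fun c d => d ≠ Letter.inv c

/-- A laminary set on `A`: a symmetric factorial set of reduced words on
`A ∪ A⁻¹`. -/
def Laminary {A : Type*} (S : Set (List (Letter A))) : Prop :=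
  FactorialSet S ∧ (∀ u ∈ S, wordInv u ∈ S) ∧ ∀ u ∈ S, Reduced u

/-- A laminary set is orientable if it splits as `S₊ ∪ S₋` with `S₊, S₋`
factorial, `S₊ ∩ S₋ = {ε}`, and `x ∈ S₋ ↔ x⁻¹ ∈ S₊`. -/
def OrientableSet {A : Type*} (S : Set (List (Letter A))) : Prop :=
  ∃ Sp Sm : Set (List (Letter A)), FactorialSet Sp ∧ FactorialSet Sm ∧
    S = Sp ∪ Sm ∧ Sp ∩ Sm = {([] : List (Letter A))} ∧
    ∀ x ∈ S, (x ∈ Sm ↔ wordInv x ∈ Sp)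

/-- A set of words is uniformly recurrent if it is right extendable and every
`u ∈ S` occurs in every long enough word of `S`. -/
def UniformlyRecurrent {α : Type*} (S : Set (List α)) : Prop :=
  (∀ u ∈ S, ∃ c : α, u ++ [c] ∈ S) ∧
  ∀ u ∈ S, ∃ n : ℕ, 1 ≤ n ∧ ∀ w ∈ S, w.length = n → u <:+: w

/-- A set of words over `A ∪ A⁻¹` is uniformly semi-recurrent if it is right
extendable and for every `u ∈ S`, every long enough word of `S` contains `u` or
`u⁻¹` as a factor. -/
def UniformlySemiRecurrent {A : Type*} (S : Set (List (Letter A))) : Prop :=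
  (∀ u ∈ S, ∃ c : Letter A, u ++ [c] ∈ S) ∧
  ∀ u ∈ S, ∃ n : ℕ, 1 ≤ n ∧ ∀ w ∈ S, w.length = n → (u <:+: w ∨ wordInv u <:+: w)

/-- A laminary set is semi-recurrent if for all `u, w ∈ S` there is `v ∈ S`
with `uvw ∈ S` or `uvw⁻¹ ∈ S`. -/
def SemiRecurrent {A : Type*} (S : Set (List (Letter A))) : Prop :=
  ∀ u ∈ S, ∀ w ∈ S, ∃ v ∈ S, u ++ v ++ w ∈ S ∨ u ++ v ++ wordInv w ∈ S

/-- A complete return word to `X ⊆ S`: a word of `S` with a proper prefix in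
`X` and a proper suffix in `X`. -/
def CompleteReturnWord {α : Type*} (S X : Set (List α)) (u : List α) : Prop :=
  u ∈ S ∧ (∃ p ∈ X, p <+: u ∧ p ≠ u) ∧ (∃ s ∈ X, s <:+ u ∧ s ≠ u)

/-- A complete first return word to `X`: a complete return word to `X` with no
internal factor in `X`. -/
def CompleteFirstReturnWord {α : Type*} (S X : Set (List α)) (u : List α) : Prop :=
  CompleteReturnWord S X u ∧
    ¬ ∃ p v s : List α, u = p ++ v ++ s ∧ v ∈ X ∧ p ≠ [] ∧ s ≠ []

/-- `CR S w`: the set of complete first return words to `{w, w⁻¹}` in `S`. -/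
def CR {A : Type*} (S : Set (List (Letter A))) (w : List (Letter A)) :
    Set (List (Letter A)) :=
  {u | CompleteFirstReturnWord S {w, wordInv w} u}

open Classical in
/-- The operation `N` on complete return words to `{w, w⁻¹}`: erase the prefix
`w` if present, and erase the suffix `w⁻¹` if present. -/
noncomputable def NN {A : Type*} (w u : List (Letter A)) : List (Letter A) :=
  let u' := if w <+: u then u.drop w.length else u
  if wordInv w <:+ u' then u'.take (u'.length - w.length) else u'

/-- `MR S w`: the set of mixed first return words to `w` in `S`. -/
noncomputable def MR {A : Type*} (S : Set (List (Letter A))) (w : List (Letter A)) :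
    Set (List (Letter A)) :=
  NN w '' CR S w

/-- `RightReturn S w`: the set of first right return words to `w` in `S`,
i.e. the words `u` such that `wu` is a complete first return word to `{w}`. -/
def RightReturn {α : Type*} (S : Set (List α)) (w : List α) : Set (List α) :=
  {u | CompleteFirstReturnWord S {w} (w ++ u)}

/-- `X` is a basis (free generating set) of the subgroup `H`: the canonical map
`FreeGroup X → G` is injective with range `H`. -/
def IsBasisOf {G : Type*} [Group G] (X : Set G) (H : Subgroup G) : Prop :=
  Function.Injective (FreeGroup.lift (fun x : X => (x : G))) ∧
    (FreeGroup.lift (fun x : X => (x : G)) : FreeGroup X →* G).range = H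

/-- `Y` is a symmetric basis of `H` if `Y = X ∪ X⁻¹` for some basis `X` of `H`. -/
def IsSymmetricBasisOf {G : Type*} [Group G] (Y : Set G) (H : Subgroup G) : Prop :=
  ∃ X : Set G, IsBasisOf X H ∧ Y = X ∪ X⁻¹

/-- The prime words in `S` with respect to a subgroup `G` of `F_A`: the
nonempty words of `G ∩ S` without a proper nonempty prefix in `G ∩ S`. -/
def PrimeWords {A : Type*} (S : Set (List (Letter A))) (G : Subgroup (FreeGroup A)) :
    Set (List (Letter A)) :=
  {u | u ∈ S ∧ u ≠ [] ∧ FreeGroup.mk u ∈ G ∧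
    ∀ p : List (Letter A), p <+: u → p ≠ [] → p ≠ u → ¬(p ∈ S ∧ FreeGroup.mk p ∈ G)}

namespace LinearInvolution

variable {A : Type*} [Fintype A] (L : LinearInvolution A)

theorem T_notMem_Ia_inv {c : Letter A} {x : ℝ × Bool} (hx : x ∈ L.Ia c) :
    L.T x ∉ L.Ia (Letter.inv c) := by
  have h : (L.s1 x).2 = L.comp (Letter.inv c) :=
    ((L.s1_image c).subset (mem_image_of_mem L.s1 hx)).2
  rintro ⟨-, hT⟩
  have hT' : (!(L.s1 x).2) = L.comp (Letter.inv c) := hT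
  simp [h] at hT'

end LinearInvolution

/-- The infinite natural coding of any `z ∈ Î ∖ Ô` is a reduced
infinite word: it has no factor `c c⁻¹`. -/
theorem stmt_2 {A : Type*} [Fintype A] (L : LinearInvolution A) :
    ∀ z ∈ L.Ihat \ L.Ohat, ∀ w : ℕ → Letter A,
      (∀ n : ℕ, (L.T)^[n] z ∈ L.Ia (w n)) →
      ∀ n : ℕ, w (n + 1) ≠ Letter.inv (w n) := by
  intro z _ w hw n h
  have hsucc := hw (n + 1)
  rw [Function.iterate_succ_apply', h] at hsucc
  exact L.T_notMem_Ia_inv (hw n) hsucc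

end LinInv
end

section
/- Let T be a nonorientable linear involution without connection. Then the natural coding L(T) equals the set of factors of the single infinite word Σ_T(z), for every z ∈ Î∖Ô; in particular the set of factors of Σ_T(z) does not depend on the choice of z ∈ Î∖Ô. -/
open Set

namespace LinInv

/-- The point at signed distance `t` from `x` in the same component. -/
def shift (x : ℝ × Bool) (t : ℝ) : ℝ × Bool := (x.1 + t, x.2)

@[simp] lemma shift_zero (x : ℝ × Bool) : shift x 0 = x := by simp [shift]

@[simp] lemma shift_shift (x : ℝ × Bool) (s t : ℝ) :
    shift (shift x s) t = shift x (s + t) := by simp [shift, add_assoc]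

@[simp] lemma s2_s2 (x : ℝ × Bool) : s2 (s2 x) = x := by simp [s2]

@[simp] lemma s2_shift (x : ℝ × Bool) (t : ℝ) : s2 (shift x t) = shift (s2 x) t := rfl

lemma eq_shift {x y : ℝ × Bool} (h : x.2 = y.2) : y = shift x (y.1 - x.1) := by
  ext <;> simp [shift, h]

lemma continuous_shift (x : ℝ × Bool) : Continuous (shift x) := by
  unfold shift; fun_prop

lemma continuous_s2 : Continuous s2 :=
  continuous_fst.prodMk ((continuous_of_discreteTopology (f := not)).comp continuous_snd)

lemma mem_nhds_iff_shift {S : Set (ℝ × Bool)} {x : ℝ × Bool} :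
    S ∈ nhds x ↔ ∃ r > 0, ∀ t : ℝ, |t| < r → shift x t ∈ S := by
  constructor
  · intro h
    have h0 : shift x ⁻¹' S ∈ nhds (0 : ℝ) :=
      (continuous_shift x).continuousAt.preimage_mem_nhds (by simpa using h)
    obtain ⟨r, hr, hrS⟩ := Metric.mem_nhds_iff.1 h0
    exact ⟨r, hr, fun t ht => hrS (by simpa using ht)⟩
  · rintro ⟨r, hr, h⟩
    refine Filter.mem_of_superset ((Metric.isOpen_ball.prod (isOpen_discrete {x.2})).mem_nhds
      (⟨Metric.mem_ball_self hr, rfl⟩ : x ∈ Metric.ball x.1 r ×ˢ ({x.2} : Set Bool))) ?_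
    rintro y ⟨hy1, hy2⟩
    rw [eq_shift (x := x) (y := y) (by simpa using hy2.symm)]
    exact h _ (by simpa [Real.dist_eq] using hy1)

/-- The open interval of length `l` starting at `p` in direction `σ` avoids `F`. -/
def Gap (F : Set (ℝ × Bool)) (p : ℝ × Bool) (σ l : ℝ) : Prop :=
  ∀ t, 0 < t → t < l → shift p (σ * t) ∉ F

lemma Gap.s2 {F : Set (ℝ × Bool)} {p : ℝ × Bool} {σ l : ℝ} (h : Gap F p σ l) :
    Gap (s2 ⁻¹' F) (s2 p) σ l := by
  intro t h0 ht hF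
  exact h t h0 ht (by simpa using hF)

/-- A closed set which meets but does not contain an interval has a gap inside it. -/
lemma exists_gap {F : Set (ℝ × Bool)} (hF : IsClosed F) {x : ℝ × Bool} (hx : x ∉ F)
    {σ s : ℝ} (hs : 0 ≤ s) (hy : shift x (σ * s) ∈ F) :
    ∃ t, 0 < t ∧ t ≤ s ∧ shift x (σ * t) ∈ F ∧ Gap F (shift x (σ * t)) (-σ) t := by
  have hK : IsCompact (Icc 0 s ∩ (fun t => shift x (σ * t)) ⁻¹' F) :=
    isCompact_Icc.inter_right
      (hF.preimage ((continuous_shift x).comp (continuous_const.mul continuous_id)))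
  obtain ⟨t, ⟨⟨h0, h1⟩, htF⟩, hmin⟩ := hK.exists_isLeast ⟨s, ⟨hs, le_rfl⟩, hy⟩
  have htF' : shift x (σ * t) ∈ F := htF
  have ht0 : 0 < t := by
    rcases h0.lt_or_eq with h | h
    · exact h
    · subst h; simp [hx] at htF'
  refine ⟨t, ht0, h1, htF, fun u hu0 hut hu => ?_⟩
  have hmem : shift x (σ * (t - u)) ∈ F := by
    have : σ * (t - u) = σ * t + -σ * u := by ring
    rw [this, ← shift_shift]; exact hu
  have := hmin ⟨⟨by linarith, by linarith⟩, hmem⟩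
  linarith

lemma Letter.inv_inv {A : Type*} (c : Letter A) : c.inv.inv = c := by simp [Letter.inv]

lemma Letter.inv_ne {A : Type*} (c : Letter A) : c.inv ≠ c := by
  intro h; have := congrArg Prod.snd h; simp [Letter.inv] at this

namespace LinearInvolution

variable {A : Type*} [Fintype A] {L : LinearInvolution A}

/-- The domain `Î ∖ Σ` of `T`. -/
def dom (L : LinearInvolution A) : Set (ℝ × Bool) := L.Ihat \ L.Sig

lemma mem_Ihat {x : ℝ × Bool} : x ∈ L.Ihat ↔ L.lo < x.1 ∧ x.1 < L.hi := by
  simp [Ihat]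

lemma s2_mem_Ihat {x : ℝ × Bool} : s2 x ∈ L.Ihat ↔ x ∈ L.Ihat := by
  simp [mem_Ihat, s2]

lemma mem_Ia {c : Letter A} {x : ℝ × Bool} :
    x ∈ L.Ia c ↔ (L.endLo c < x.1 ∧ x.1 < L.endHi c) ∧ x.2 = L.comp c := by
  simp [Ia]

lemma isOpen_Ia (c : Letter A) : IsOpen (L.Ia c) := isOpen_Ioo.prod (isOpen_discrete _)

lemma Ia_subset_dom (c : Letter A) : L.Ia c ⊆ L.dom := by
  intro x hx
  refine ⟨?_, fun h => Set.disjoint_left.1 (L.Sig_disj c) h hx⟩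
  have := mem_Ia.1 hx
  exact mem_Ihat.2 ⟨(L.sub_lo c).trans_lt this.1.1, this.1.2.trans_le (L.sub_hi c)⟩

lemma mem_dom {x : ℝ × Bool} : x ∈ L.dom ↔ ∃ c, x ∈ L.Ia c := by
  constructor
  · rintro ⟨h, hS⟩
    have h' : x ∈ (⋃ c : Letter A, Ioo (L.endLo c) (L.endHi c) ×ˢ ({L.comp c} : Set Bool)) ∪
        L.Sig := L.cover ▸ h
    exact (mem_iUnion.1 (h'.resolve_right hS))
  · rintro ⟨c, hc⟩; exact Ia_subset_dom c hc

lemma s1_mem_Ia {c : Letter A} {x : ℝ × Bool} (hx : x ∈ L.Ia c) : L.s1 x ∈ L.Ia c.inv := by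
  have := mem_image_of_mem L.s1 hx
  unfold Ia at this
  rwa [L.s1_image c] at this

lemma s1_mem_dom {x : ℝ × Bool} (hx : x ∈ L.dom) : L.s1 x ∈ L.dom := by
  obtain ⟨c, hc⟩ := mem_dom.1 hx
  exact Ia_subset_dom _ (s1_mem_Ia hc)

lemma s2_T (x : ℝ × Bool) : s2 (L.T x) = L.s1 x := by simp [T]

lemma T_mem_Ihat {x : ℝ × Bool} (hx : x ∈ L.dom) : L.T x ∈ L.Ihat :=
  s2_mem_Ihat.2 (s1_mem_dom hx).1

lemma s2_T_mem_dom {x : ℝ × Bool} (hx : x ∈ L.dom) : s2 (L.T x) ∈ L.dom := by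
  rw [s2_T]; exact s1_mem_dom hx

lemma T_s2_T {x : ℝ × Bool} (hx : x ∈ L.dom) : L.T (s2 (L.T x)) = s2 x := by
  rw [s2_T, T, L.s1_invol x hx]

lemma T_injOn {x y : ℝ × Bool} (hx : x ∈ L.dom) (hy : y ∈ L.dom) (h : L.T x = L.T y) :
    x = y := by
  have := T_s2_T hx
  rw [h, T_s2_T hy] at this
  simpa using (congrArg s2 this).symm

lemma iterate_s2_iterate {n : ℕ} {x : ℝ × Bool} (hx : ∀ i < n, L.T^[i] x ∈ L.dom) :
    L.T^[n] (s2 (L.T^[n] x)) = s2 x := by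
  induction n with
  | zero => simp
  | succ n ih =>
    rw [Function.iterate_succ_apply, Function.iterate_succ_apply',
      T_s2_T (hx n n.lt_succ_self), ih fun i hi => hx i (hi.trans n.lt_succ_self)]

lemma exists_T_eq (c : Letter A) : ∃ ε : ℝ, (ε = 1 ∨ ε = -1) ∧ ∀ x ∈ L.Ia c, ∀ t,
    shift x t ∈ L.Ia c → L.T (shift x t) = shift (L.T x) (ε * t) := by
  rcases L.s1_iso c with ⟨α, h⟩ | ⟨α, h⟩
  · refine ⟨1, .inl rfl, fun x hx t ht => ?_⟩
    rw [T, T, h x hx, h _ ht]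
    ext <;> simp [shift, s2]; ring
  · refine ⟨-1, .inr rfl, fun x hx t ht => ?_⟩
    rw [T, T, h x hx, h _ ht]
    ext <;> simp [shift, s2]; ring

lemma subset_Ia {S : Set (ℝ × Bool)} (hS : IsPreconnected S) (hd : S ⊆ L.dom)
    {c : Letter A} {x : ℝ × Bool} (hx : x ∈ S) (hc : x ∈ L.Ia c) : S ⊆ L.Ia c := by
  refine hS.subset_left_of_subset_union (v := ⋃ d ∈ {d | d ≠ c}, L.Ia d) (isOpen_Ia c)
    (isOpen_biUnion fun d _ => isOpen_Ia d) ?_ ?_ ⟨x, hx, hc⟩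
  · simp only [disjoint_iUnion_right]
    exact fun d hd => L.disj c d (Ne.symm hd)
  · intro y hy
    obtain ⟨d, hyd⟩ := mem_dom.1 (hd hy)
    by_cases h : d = c
    · exact .inl (h ▸ hyd)
    · exact .inr (mem_biUnion (show d ∈ {d | d ≠ c} from h) hyd)

lemma exists_T_eq_of_segment {x : ℝ × Bool} {σ l : ℝ} (hl : 0 < l)
    (h : ∀ t, 0 ≤ t → t < l → shift x (σ * t) ∈ L.dom) :
    ∃ ε : ℝ, (ε = 1 ∨ ε = -1) ∧
      ∀ t, 0 ≤ t → t < l → L.T (shift x (σ * t)) = shift (L.T x) (ε * (σ * t)) := by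
  have hx : x ∈ L.dom := by simpa using h 0 le_rfl hl
  obtain ⟨c, hc⟩ := mem_dom.1 hx
  obtain ⟨ε, hε, hT⟩ := L.exists_T_eq c
  have hsub : (fun t => shift x (σ * t)) '' Ico 0 l ⊆ L.Ia c := by
    refine subset_Ia (isPreconnected_Ico.image _ ?_) ?_ ⟨0, ⟨le_rfl, hl⟩, by simp⟩ hc
    · exact ((continuous_shift x).comp (continuous_const.mul continuous_id)).continuousOn
    · rintro _ ⟨t, ht, rfl⟩; exact h t ht.1 ht.2
  exact ⟨ε, hε, fun t h0 h1 => hT x hc _ (hsub ⟨t, ⟨h0, h1⟩, rfl⟩)⟩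

/-- `T` is a local isometry on its domain. -/
lemma exists_local_T {x : ℝ × Bool} (hx : x ∈ L.dom) :
    ∃ r > 0, ∃ ε : ℝ, (ε = 1 ∨ ε = -1) ∧ ∀ t, |t| < r →
      shift x t ∈ L.dom ∧ L.T (shift x t) = shift (L.T x) (ε * t) := by
  obtain ⟨c, hc⟩ := mem_dom.1 hx
  obtain ⟨ε, hε, hT⟩ := L.exists_T_eq c
  obtain ⟨r, hr, h⟩ := mem_nhds_iff_shift.1 ((isOpen_Ia c).mem_nhds hc)
  exact ⟨r, hr, ε, hε, fun t ht => ⟨Ia_subset_dom c (h t ht), hT x hc t (h t ht)⟩⟩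

lemma exists_local_iterate {n : ℕ} {x : ℝ × Bool} (hx : ∀ i < n, L.T^[i] x ∈ L.dom) :
    ∃ r > 0, ∃ ε : ℝ, (ε = 1 ∨ ε = -1) ∧ ∀ t, |t| < r →
      (∀ i < n, L.T^[i] (shift x t) ∈ L.dom) ∧
        L.T^[n] (shift x t) = shift (L.T^[n] x) (ε * t) := by
  induction n with
  | zero => exact ⟨1, one_pos, 1, .inl rfl, fun t _ => by simp⟩
  | succ n ih =>
    obtain ⟨r, hr, ε, hε, h⟩ := ih fun i hi => hx i (hi.trans n.lt_succ_self)
    obtain ⟨r', hr', ε', hε', h'⟩ := exists_local_T (hx n n.lt_succ_self)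
    have habs : |ε| = 1 := by rcases hε with rfl | rfl <;> simp
    refine ⟨min r r', lt_min hr hr', ε' * ε, ?_, fun t ht => ?_⟩
    · rcases hε with rfl | rfl <;> rcases hε' with rfl | rfl <;> simp
    · obtain ⟨h1, h2⟩ := h t (ht.trans_le (min_le_left _ _))
      obtain ⟨h3, h4⟩ := h' (ε * t) (by rw [abs_mul, habs, one_mul]
                                        exact ht.trans_le (min_le_right _ _))
      refine ⟨fun i hi => ?_, ?_⟩
      · rcases Nat.lt_succ_iff_lt_or_eq.1 hi with hi | rfl
        · exact h1 i hi
        · rw [h2]; exact h3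
      · rw [Function.iterate_succ_apply', h2, h4, Function.iterate_succ_apply', mul_assoc]

lemma iterate_notMem_O {x : ℝ × Bool} (hx : x ∉ L.O) (n : ℕ) : L.T^[n] x ∉ L.O := by
  simp only [O, mem_iUnion, mem_preimage, not_exists] at hx ⊢
  intro m
  rw [← Function.iterate_add_apply]
  exact hx _

lemma notMem_Sig_of_notMem_O {x : ℝ × Bool} (hx : x ∉ L.O) : x ∉ L.Sig := fun h =>
  hx (mem_iUnion.2 ⟨0, h⟩)

lemma iterate_mem_dom {x : ℝ × Bool} (hx : x ∈ L.Ihat) (hO : x ∉ L.O) (n : ℕ) :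
    L.T^[n] x ∈ L.dom := by
  induction n with
  | zero => exact ⟨hx, notMem_Sig_of_notMem_O hO⟩
  | succ n ih =>
    refine ⟨?_, notMem_Sig_of_notMem_O (iterate_notMem_O hO _)⟩
    rw [Function.iterate_succ_apply']; exact T_mem_Ihat ih

lemma iterate_mem_dom_of_lt {n : ℕ} {x : ℝ × Bool} (hx : x ∈ L.Ihat)
    (h : ∀ i < n, L.T^[i] x ∉ L.Sig) : ∀ i < n, L.T^[i] x ∈ L.dom := by
  intro i
  induction i with
  | zero => exact fun hi => ⟨hx, h 0 hi⟩
  | succ i ih =>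
    intro hi
    refine ⟨?_, h _ hi⟩
    rw [Function.iterate_succ_apply']
    exact T_mem_Ihat (ih (i.lt_succ_self.trans hi))

lemma hasConnection_of_mem_O {x : ℝ × Bool} (hx : x ∈ L.Ihat) (h : x ∈ L.O)
    (h' : s2 x ∈ L.O) : L.HasConnection := by
  classical
  obtain ⟨m, hm⟩ := mem_iUnion.1 h
  have hex : ∃ n, L.T^[n] (s2 x) ∈ L.Sig := mem_iUnion.1 h'
  have hdom := iterate_mem_dom_of_lt (s2_mem_Ihat.2 hx) fun i hi => Nat.find_min hex hi
  refine ⟨_, ⟨_, Nat.find_spec hex, rfl⟩, m + Nat.find hex, ?_⟩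
  rw [Function.iterate_add_apply, iterate_s2_iterate hdom, s2_s2]
  exact hm

/-- A closed set all of whose gaps end in points hitting singularities in both directions
contains every component of `Î` that it meets. -/
lemma mem_of_gap_mem_O (hnc : ¬ L.HasConnection) {F : Set (ℝ × Bool)} (hF : IsClosed F)
    (hgap : ∀ p ∈ L.Ihat, p ∈ F → ∀ σ l : ℝ, (σ = 1 ∨ σ = -1) → 0 < l → Gap F p σ l →
      p ∈ L.O ∧ s2 p ∈ L.O)
    {x y : ℝ × Bool} (hx : x ∈ L.Ihat) (hy : y ∈ L.Ihat) (hxy : x.2 = y.2) (hyF : y ∈ F) :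
    x ∈ F := by
  by_contra hxF
  obtain ⟨σ, hσ, s, hs, hsy⟩ : ∃ σ : ℝ, (σ = 1 ∨ σ = -1) ∧ ∃ s ≥ 0, y = shift x (σ * s) := by
    rcases le_total x.1 y.1 with h | h
    · exact ⟨1, .inl rfl, y.1 - x.1, by simpa using h, by rw [one_mul]; exact eq_shift hxy⟩
    · refine ⟨-1, .inr rfl, x.1 - y.1, by simpa using h, ?_⟩
      rw [neg_one_mul, neg_sub]; exact eq_shift hxy
  subst hsy
  obtain ⟨t, ht0, hts, htF, hg⟩ := exists_gap hF hxF hs hyF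
  have hI : shift x (σ * t) ∈ L.Ihat := by
    rw [mem_Ihat] at hx hy ⊢
    simp only [shift] at hy ⊢
    rcases hσ with rfl | rfl <;> constructor <;> linarith
  obtain ⟨h1, h2⟩ := hgap _ hI htF (-σ) t (by rcases hσ with rfl | rfl <;> simp) ht0 hg
  exact hnc (hasConnection_of_mem_O hI h1 h2)

lemma exists_mem_Sig (hno : L.Nonorientable) (δ : Bool) :
    ∃ x ∈ L.Sig, x.2 = δ := by
  by_contra! h
  have hsub : Ioo L.lo L.hi ×ˢ ({δ} : Set Bool) ⊆ L.dom := by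
    rintro x ⟨hx, hδ⟩
    exact ⟨⟨hx, mem_univ _⟩, fun hS => h x hS hδ⟩
  have hmid : (((L.lo + L.hi) / 2, δ) : ℝ × Bool) ∈ Ioo L.lo L.hi ×ˢ ({δ} : Set Bool) := by
    have := L.lo_lt_hi
    exact ⟨⟨by linarith, by linarith⟩, rfl⟩
  obtain ⟨c, hc⟩ := mem_dom.1 (hsub hmid)
  have hIa := subset_Ia (isPreconnected_Ioo.prod isPreconnected_singleton) hsub hmid hc
  have hcδ : δ = L.comp c := (mem_Ia.1 hc).2
  have hIoo : Ioo L.lo L.hi ⊆ Ioo (L.endLo c) (L.endHi c) := fun t ht =>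
    (mem_Ia.1 (hIa (⟨ht, rfl⟩ : (t, δ) ∈ Ioo L.lo L.hi ×ˢ ({δ} : Set Bool)))).1
  obtain ⟨h1, h2⟩ := (Ioo_subset_Ioo_iff L.lo_lt_hi).1 hIoo
  have hlen := L.len_inv c
  have hlo := L.sub_lo c.inv
  have hhi := L.sub_hi c.inv
  have eq_of_full : ∀ d e : Letter A, L.endLo d ≤ L.lo → L.hi ≤ L.endHi d →
      L.comp e = L.comp d → e = d := by
    intro d e hd1 hd2 hed
    by_contra hne
    have hm : (((L.endLo e + L.endHi e) / 2, L.comp e) : ℝ × Bool) ∈ L.Ia e := by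
      have := L.end_lt e
      exact mem_Ia.2 ⟨⟨by dsimp; linarith, by dsimp; linarith⟩, rfl⟩
    have hI := mem_Ihat.1 (Ia_subset_dom e hm).1
    exact Set.disjoint_left.1 (L.disj e d hne) hm
      (mem_Ia.2 ⟨⟨by linarith [hI.1], by linarith [hI.2]⟩, hed⟩)
  have hcc : L.comp c.inv ≠ L.comp c := fun heq => c.inv_ne (eq_of_full c c.inv h1 h2 heq)
  obtain ⟨e, he⟩ := hno
  by_cases hec : L.comp e = L.comp c
  · have := eq_of_full c e h1 h2 hec
    subst this
    exact hcc he.symm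
  · have hec' : L.comp e = L.comp c.inv := by
      cases h3 : L.comp e <;> cases h4 : L.comp c <;> cases h5 : L.comp c.inv <;> simp_all
    have := eq_of_full c.inv e (by linarith) (by linarith) hec'
    subst this
    rw [Letter.inv_inv] at he
    exact hec he

/-- A linear involution without connection has no periodic point. -/
lemma iterate_ne_self (hnc : ¬ L.HasConnection) (hno : L.Nonorientable) {x : ℝ × Bool}
    (hx : x ∈ L.Ihat) (hO : x ∉ L.O) {m : ℕ} (hm : 0 < m) : L.T^[m] x ≠ x := by
  intro hper
  set E : Set (ℝ × Bool) := {y | (∀ i < m + m, L.T^[i] y ∈ L.dom) ∧ L.T^[m + m] y = y} with hE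
  have hs2E : ∀ y ∈ E, s2 y ∈ E := by
    rintro y ⟨hy, hyy⟩
    constructor
    · intro i hi
      have h1 : L.T^[i] (s2 y) = s2 (L.T^[m + m - i] y) := by
        conv_lhs => rw [← hyy, show m + m = i + (m + m - i) by omega, Function.iterate_add_apply]
        refine iterate_s2_iterate fun j hj => ?_
        rw [← Function.iterate_add_apply]
        exact hy _ (by omega)
      rw [h1, show m + m - i = (m + m - i - 1) + 1 by omega, Function.iterate_succ_apply']
      exact s2_T_mem_dom (hy _ (by omega))
    · conv_lhs => rw [← hyy]
      exact iterate_s2_iterate hy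
  have hs2 : ∀ y ∈ interior E, s2 y ∈ interior E := by
    intro y hy
    refine mem_interior.2 ⟨s2 ⁻¹' interior E, ?_, isOpen_interior.preimage continuous_s2,
      by simpa using hy⟩
    intro w hw
    simpa using hs2E _ (interior_subset hw)
  have hxE : x ∈ interior E := by
    obtain ⟨r, hr, ε, hε, h⟩ := exists_local_iterate (n := m) fun i _ => iterate_mem_dom hx hO i
    rw [hper] at h
    refine mem_interior_iff_mem_nhds.2 (mem_nhds_iff_shift.2 ⟨r, hr, fun t ht => ?_⟩)
    have hεt : |ε * t| < r := by rcases hε with rfl | rfl <;> simpa using ht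
    constructor
    · intro i hi
      rcases lt_or_ge i m with him | him
      · exact (h t ht).1 i him
      · obtain ⟨j, rfl⟩ := Nat.exists_eq_add_of_le' him
        rw [Function.iterate_add_apply, (h t ht).2]
        exact (h _ hεt).1 j (by omega)
    · rw [Function.iterate_add_apply, (h t ht).2, (h _ hεt).2, ← mul_assoc]
      rcases hε with rfl | rfl <;> simp
  have hfwd : ∀ p ∈ L.Ihat, p ∉ interior E → ∀ σ l : ℝ, (σ = 1 ∨ σ = -1) → 0 < l →
      Gap (interior E)ᶜ p σ l → p ∈ L.O := by
    intro p hp hpE σ l hσ hl hgap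
    by_contra hpO
    apply hpE
    obtain ⟨r, hr, ε, hε, h⟩ :=
      exists_local_iterate (n := m + m) fun i _ => iterate_mem_dom hp hpO i
    have key : ∀ t, 0 < t → t < min r l →
        shift p (σ * t) = shift (L.T^[m + m] p) (ε * (σ * t)) := by
      intro t ht0 ht
      have h1 : shift p (σ * t) ∈ E := interior_subset (not_not.1 (hgap t ht0
        (ht.trans_le (min_le_right _ _))))
      rw [← (h (σ * t) ?_).2, h1.2]
      have : |σ * t| = t := by rcases hσ with rfl | rfl <;> simp [abs_of_pos ht0]
      rw [this]; exact ht.trans_le (min_le_left _ _)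
    have hrl : 0 < min r l := lt_min hr hl
    have k1 := key (min r l / 2) (by linarith) (by linarith)
    have k2 := key (min r l / 3) (by linarith) (by linarith)
    have k11 := congrArg Prod.fst k1
    have k21 := congrArg Prod.fst k2
    have k12 : p.2 = (L.T^[m + m] p).2 := by simpa [shift] using congrArg Prod.snd k1
    simp only [shift] at k11 k21
    have hε1 : ε = 1 := by
      rcases hε with h1 | h1
      · exact h1
      · exfalso; rcases hσ with rfl | rfl <;> rw [h1] at k11 k21 <;> linarith
    subst hε1
    have hp2 : L.T^[m + m] p = p := Prod.ext (by linarith) k12.symm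
    refine mem_interior_iff_mem_nhds.2 (mem_nhds_iff_shift.2 ⟨r, hr, fun t ht => ?_⟩)
    refine ⟨(h t ht).1, ?_⟩
    rw [(h t ht).2, hp2, one_mul]
  have hs2c : s2 ⁻¹' (interior E)ᶜ = (interior E)ᶜ := by
    ext y
    exact not_congr ⟨fun h => by simpa using hs2 _ h, hs2 y⟩
  obtain ⟨y, hyS, hyx⟩ := exists_mem_Sig hno x.2
  have hyE : y ∉ interior E := fun h =>
    ((interior_subset h).1 0 (by omega)).2 hyS
  refine (mem_of_gap_mem_O hnc isOpen_interior.isClosed_compl ?_ hx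
    (L.Sig_sub hyS) hyx.symm hyE) hxE
  intro p hp hpE σ l hσ hl hgap
  refine ⟨hfwd p hp hpE σ l hσ hl hgap, hfwd (s2 p) (s2_mem_Ihat.2 hp) ?_ σ l hσ hl ?_⟩
  · exact fun h => hpE (by simpa using hs2 _ h)
  · rw [← hs2c]; exact hgap.s2

lemma iterate_injective (hnc : ¬ L.HasConnection) (hno : L.Nonorientable) {x : ℝ × Bool}
    (hx : x ∈ L.Ihat) (hO : x ∉ L.O) : Function.Injective fun n => L.T^[n] x := by
  have key : ∀ i j, i < j → L.T^[i] x ≠ L.T^[j] x := by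
    intro i j hij h
    refine iterate_ne_self hnc hno (iterate_mem_dom hx hO i).1 (iterate_notMem_O hO i)
      (Nat.sub_pos_of_lt hij) ?_
    rw [← Function.iterate_add_apply, Nat.sub_add_cancel hij.le, h]
  intro i j h
  rcases lt_trichotomy i j with hij | hij | hij
  · exact (key i j hij h).elim
  · exact hij
  · exact (key j i hij h.symm).elim

lemma finite_Sig (hnc : ¬ L.HasConnection) (hno : L.Nonorientable) : L.Sig.Finite := by
  by_contra hinf
  have hcard : Fintype.card A ≤ 1 := by
    have := L.Sig_card
    rw [Set.Infinite.ncard hinf] at this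
    omega
  obtain ⟨e, he⟩ := hno
  obtain ⟨x, hxS, hx⟩ := exists_mem_Sig ⟨e, he⟩ (L.comp e)
  refine hnc ⟨x, ⟨s2 x, ?_, s2_s2 x⟩, 0, hxS⟩
  by_contra hS
  obtain ⟨c, hc⟩ := mem_dom.1 (⟨s2_mem_Ihat.2 (L.Sig_sub hxS), hS⟩ : s2 x ∈ L.dom)
  have h1 : c.1 = e.1 := Fintype.card_le_one_iff.1 hcard _ _
  have h2 : (!x.2) = L.comp c := (mem_Ia.1 hc).2
  have h3 : c = e ∨ c = e.inv := by
    obtain ⟨a, b⟩ := c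
    obtain ⟨a', b'⟩ := e
    simp only at h1
    subst h1
    cases b <;> cases b' <;> simp [Letter.inv]
  rcases h3 with rfl | rfl
  · rw [← hx] at h2; simp at h2
  · rw [← he, ← hx] at h2; simp at h2

/-- `F` is invariant under `T` and its inverse. -/
def Inv (L : LinearInvolution A) (F : Set (ℝ × Bool)) : Prop :=
  ∀ x ∈ L.dom, (x ∈ F ↔ L.T x ∈ F)

lemma Inv.s2 {F : Set (ℝ × Bool)} (h : L.Inv F) : L.Inv (s2 ⁻¹' F) := by
  intro x hx
  have := h _ (s2_T_mem_dom hx)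
  rw [T_s2_T hx] at this
  exact this.symm

lemma Gap.eq_of_mem {F : Set (ℝ × Bool)} {p q : ℝ × Bool} {σ l : ℝ} (hp : p ∈ F) (hq : q ∈ F)
    (hσ : σ = 1 ∨ σ = -1) (hgp : Gap F p σ l) (hgq : Gap F q σ l) (h2 : p.2 = q.2)
    (hd : |p.1 - q.1| < l) : p = q := by
  by_contra hne
  have h1 : p.1 ≠ q.1 := fun h => hne (Prod.ext h h2)
  have hpq := hgp (σ * (q.1 - p.1))
  have hqp := hgq (σ * (p.1 - q.1))
  rw [← mul_assoc, show σ * σ = 1 by rcases hσ with rfl | rfl <;> norm_num, one_mul] at hpq hqp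
  rw [← eq_shift h2] at hpq
  rw [← eq_shift h2.symm] at hqp
  rw [abs_lt] at hd
  rcases lt_or_gt_of_ne h1 with h | h <;> rcases hσ with rfl | rfl
  · exact hpq (by linarith) (by linarith) hq
  · exact hqp (by linarith) (by linarith) hp
  · exact hqp (by linarith) (by linarith) hp
  · exact hpq (by linarith) (by linarith) hq

lemma Gap.le_of_shift_eq {F : Set (ℝ × Bool)} {p q : ℝ × Bool} {σ l s t : ℝ} (hp : p ∈ F)
    (hq : Gap F q σ l) (hs : 0 < s) (ht : t < l) (h : shift p (σ * s) = shift q (σ * t)) :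
    t ≤ s := by
  by_contra! hlt
  refine hq (t - s) (by linarith) (by linarith) ?_
  rw [show σ * (t - s) = σ * t + -(σ * s) by ring, ← shift_shift, ← h]
  simpa using hp

/-- The endpoint of a gap of an invariant set reaches a singularity. -/
lemma mem_O_of_gap (hnc : ¬ L.HasConnection) (hno : L.Nonorientable) {F : Set (ℝ × Bool)}
    (hF : L.Inv F) {p : ℝ × Bool} (hp : p ∈ L.Ihat) (hpF : p ∈ F) {σ l : ℝ}
    (hσ : σ = 1 ∨ σ = -1) (hl : 0 < l) (hgap : Gap F p σ l) : p ∈ L.O := by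
  by_contra hO
  have hdom := iterate_mem_dom hp hO
  have hinj := iterate_injective hnc hno hp hO
  have horb : ∀ n, L.T^[n] p ∈ F := by
    intro n
    induction n with
    | zero => exact hpF
    | succ n ih => rw [Function.iterate_succ_apply']; exact (hF _ (hdom n)).1 ih
  -- Gaps within `Î`, at all points of the orbit.
  have hshort : ∀ n, ∃ σ l : ℝ, (σ = 1 ∨ σ = -1) ∧ 0 < l ∧ Gap F (L.T^[n] p) σ l ∧
      ∀ t, 0 < t → t < l → shift (L.T^[n] p) (σ * t) ∈ L.Ihat := by
    intro n
    induction n with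
    | zero =>
      obtain ⟨r, hr, ε, -, h⟩ := exists_local_T (hdom 0)
      refine ⟨σ, min l r, hσ, lt_min hl hr, fun t h0 ht =>
        hgap t h0 (ht.trans_le (min_le_left _ _)), fun t h0 ht => (h _ ?_).1.1⟩
      have : |σ * t| = t := by rcases hσ with rfl | rfl <;> simp [abs_of_pos h0]
      rw [this]; exact ht.trans_le (min_le_right _ _)
    | succ n ih =>
      obtain ⟨σ, l, hσ, hl, hg, -⟩ := ih
      obtain ⟨r, hr, ε, hε, h⟩ := exists_local_T (hdom n)
      have habs : ∀ t, 0 < t → t < min l r → |σ * t| < r := by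
        intro t h0 ht
        have : |σ * t| = t := by rcases hσ with rfl | rfl <;> simp [abs_of_pos h0]
        rw [this]; exact ht.trans_le (min_le_right _ _)
      refine ⟨ε * σ, min l r, ?_, lt_min hl hr, fun t h0 ht => ?_, fun t h0 ht => ?_⟩
      · rcases hε with rfl | rfl <;> rcases hσ with rfl | rfl <;> simp
      · obtain ⟨h1, h2⟩ := h _ (habs t h0 ht)
        rw [Function.iterate_succ_apply', mul_assoc, ← h2]
        exact fun hmem => hg t h0 (ht.trans_le (min_le_left _ _)) ((hF _ h1).2 hmem)
      · obtain ⟨h1, h2⟩ := h _ (habs t h0 ht)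
        rw [Function.iterate_succ_apply', mul_assoc, ← h2]
        exact T_mem_Ihat h1
  -- Only finitely many orbit points have a gap containing a singularity.
  set Bad : Set ℕ := {n | ∃ σ l t : ℝ, (σ = 1 ∨ σ = -1) ∧ Gap F (L.T^[n] p) σ l ∧
    0 < t ∧ t < l ∧ shift (L.T^[n] p) (σ * t) ∈ L.Sig} with hBad
  have hBadfin : Bad.Finite := by
    by_contra hinf
    have hex : ∀ n : ℕ, ∃ q : ℝ × (ℝ × Bool), n ∈ Bad → q ∈ ({1, -1} : Set ℝ) ×ˢ L.Sig ∧
        ∃ l t : ℝ, Gap F (L.T^[n] p) q.1 l ∧ 0 < t ∧ t < l ∧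
          shift (L.T^[n] p) (q.1 * t) = q.2 := by
      intro n
      by_cases hn : n ∈ Bad
      · obtain ⟨σ, l, t, hσ, hg, h0, ht, hS⟩ := hn
        exact ⟨(σ, shift (L.T^[n] p) (σ * t)), fun _ =>
          ⟨⟨by simpa using hσ, hS⟩, l, t, hg, h0, ht, rfl⟩⟩
      · exact ⟨(0, p), fun h => (hn h).elim⟩
    choose f hf using hex
    obtain ⟨n, hn, m, hm, hne, heq⟩ := Set.Infinite.exists_ne_map_eq_of_mapsTo hinf
      (fun n hn => (hf n hn).1) ((Set.toFinite _).prod (finite_Sig hnc hno))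
    obtain ⟨⟨hσ, -⟩, l, t, hg, h0, ht, hy⟩ := hf n hn
    obtain ⟨-, l', t', hg', h0', ht', hy'⟩ := hf m hm
    rw [← heq] at hg' hy'
    rw [← hy] at hy'
    have hσ' : (f n).1 = 1 ∨ (f n).1 = -1 := by simpa using hσ
    have htt : t = t' := le_antisymm (Gap.le_of_shift_eq (horb m) hg h0' ht hy')
      (Gap.le_of_shift_eq (horb n) hg' h0 ht' hy'.symm)
    subst htt
    refine hne (hinj (Prod.ext ?_ (by simpa [shift] using (congrArg Prod.snd hy').symm)))
    simpa [shift] using (congrArg Prod.fst hy').symm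
  obtain ⟨N, hN⟩ := hBadfin.bddAbove
  obtain ⟨τ, k, hτ, hk, hgk, hIk⟩ := hshort (N + 1)
  have hlong : ∀ n, ∃ σ : ℝ, (σ = 1 ∨ σ = -1) ∧ Gap F (L.T^[n + (N + 1)] p) σ k ∧
      ∀ t, 0 < t → t < k → shift (L.T^[n + (N + 1)] p) (σ * t) ∈ L.Ihat := by
    intro n
    induction n with
    | zero => exact ⟨τ, hτ, by simpa using hgk, by simpa using hIk⟩
    | succ n ih =>
      obtain ⟨σ, hσ, hg, hI⟩ := ih
      have hseg : ∀ t, 0 ≤ t → t < k → shift (L.T^[n + (N + 1)] p) (σ * t) ∈ L.dom := by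
        intro t h0 ht
        rcases h0.eq_or_lt with rfl | h0
        · simpa using hdom _
        · refine ⟨hI t h0 ht, fun hS => ?_⟩
          have := hN (show n + (N + 1) ∈ Bad from ⟨σ, k, t, hσ, hg, h0, ht, hS⟩)
          omega
      obtain ⟨ε, hε, h⟩ := exists_T_eq_of_segment hk hseg
      refine ⟨ε * σ, ?_, fun t h0 ht => ?_, fun t h0 ht => ?_⟩
      · rcases hε with rfl | rfl <;> rcases hσ with rfl | rfl <;> simp
      · rw [add_right_comm, Function.iterate_succ_apply', mul_assoc, ← h t h0.le ht]
        exact fun hmem => hg t h0 ht ((hF _ (hseg t h0.le ht)).2 hmem)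
      · rw [add_right_comm, Function.iterate_succ_apply', mul_assoc, ← h t h0.le ht]
        exact T_mem_Ihat (hseg t h0.le ht)
  choose f hf hfg _ using hlong
  have hmaps : MapsTo (fun n => (f n, (L.T^[n + (N + 1)] p).2, ⌊(L.T^[n + (N + 1)] p).1 / k⌋))
      univ (({1, -1} : Set ℝ) ×ˢ (univ : Set Bool) ×ˢ Icc ⌊L.lo / k⌋ ⌊L.hi / k⌋) := by
    intro n _
    have := mem_Ihat.1 (hdom (n + (N + 1))).1
    refine ⟨by simpa using hf n, mem_univ _, Int.floor_mono ?_, Int.floor_mono ?_⟩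
    · exact div_le_div_of_nonneg_right this.1.le hk.le
    · exact div_le_div_of_nonneg_right this.2.le hk.le
  obtain ⟨n, -, m, -, hne, heq⟩ := Set.Infinite.exists_ne_map_eq_of_mapsTo
    (Set.infinite_univ (α := ℕ)) hmaps (Set.toFinite _)
  simp only [Prod.mk.injEq] at heq
  obtain ⟨h1, h2, h3⟩ := heq
  have hd := Int.abs_sub_lt_one_of_floor_eq_floor h3
  rw [← sub_div, abs_div, abs_of_pos hk, div_lt_one hk] at hd
  have := hinj (Gap.eq_of_mem (horb _) (horb _) (hf n) (hfg n) (h1 ▸ hfg m) h2 hd)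
  omega

/-- A closed invariant set which meets `Î` contains `Î`. -/
lemma Ihat_subset_of_inv (hnc : ¬ L.HasConnection) (hno : L.Nonorientable)
    {F : Set (ℝ × Bool)} (hFc : IsClosed F) (hF : L.Inv F) {x : ℝ × Bool} (hx : x ∈ L.Ihat)
    (hxF : x ∈ F) : L.Ihat ⊆ F := by
  have hcomp : ∀ y ∈ L.Ihat, ∀ z ∈ L.Ihat, y.2 = z.2 → z ∈ F → y ∈ F := by
    intro y hy z hz hyz hzF
    refine mem_of_gap_mem_O hnc hFc (fun p hp hpF σ l hσ hl hg => ?_) hy hz hyz hzF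
    exact ⟨mem_O_of_gap hnc hno hF hp hpF hσ hl hg,
      mem_O_of_gap hnc hno hF.s2 (s2_mem_Ihat.2 hp) (by simpa using hpF) hσ hl hg.s2⟩
  obtain ⟨c, hc⟩ := id hno
  have hw : (((L.endLo c + L.endHi c) / 2, L.comp c) : ℝ × Bool) ∈ L.Ia c := by
    have := L.end_lt c
    exact mem_Ia.2 ⟨⟨by dsimp; linarith, by dsimp; linarith⟩, rfl⟩
  generalize ((L.endLo c + L.endHi c) / 2, L.comp c) = w at hw
  have hwd := Ia_subset_dom c hw
  have hne : (L.T w).2 = !w.2 := by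
    rw [(mem_Ia.1 hw).2, hc, ← (mem_Ia.1 (s1_mem_Ia hw)).2]; rfl
  have hT := T_mem_Ihat hwd
  have hwF : w ∈ F := by
    by_cases h : w.2 = x.2
    · exact hcomp w hwd.1 x hx h hxF
    · refine (hF w hwd).2 (hcomp _ hT x hx ?_ hxF)
      rw [hne]; cases h1 : w.2 <;> cases h2 : x.2 <;> simp_all
  intro y hy
  by_cases h : y.2 = w.2
  · exact hcomp y hy w hwd.1 h hwF
  · refine hcomp y hy _ hT ?_ ((hF w hwd).1 hwF)
    rw [hne]; cases h1 : y.2 <;> cases h2 : w.2 <;> simp_all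

/-- The set of accumulation points of the forward orbit of `z`. -/
def omegaSet (L : LinearInvolution A) (z : ℝ × Bool) : Set (ℝ × Bool) :=
  {x | MapClusterPt x Filter.atTop fun n => L.T^[n] z}

lemma isClosed_omegaSet (z : ℝ × Bool) : IsClosed (L.omegaSet z) := isClosed_setOfPred_clusterPt

lemma mem_omegaSet {x z : ℝ × Bool} : x ∈ L.omegaSet z ↔
    ∀ r > 0, ∀ M : ℕ, ∃ n ≥ M, ∃ t, |t| < r ∧ L.T^[n] z = shift x t := by
  rw [omegaSet, mem_ofPred_eq, mapClusterPt_iff_frequently]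
  simp only [Filter.frequently_atTop]
  constructor
  · intro h r hr M
    obtain ⟨n, hn, t, ht, heq⟩ := h (shift x '' {t | |t| < r})
      (mem_nhds_iff_shift.2 ⟨r, hr, fun t ht => ⟨t, ht, rfl⟩⟩) M
    exact ⟨n, hn, t, ht, heq.symm⟩
  · intro h S hS M
    obtain ⟨r, hr, hrS⟩ := mem_nhds_iff_shift.1 hS
    obtain ⟨n, hn, t, ht, heq⟩ := h r hr M
    exact ⟨n, hn, heq ▸ hrS t ht⟩

lemma inv_omegaSet {z : ℝ × Bool} (hz : z ∈ L.Ihat) (hO : z ∉ L.O) : L.Inv (L.omegaSet z) := by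
  intro x hx
  obtain ⟨r₀, hr₀, ε, hε, h⟩ := exists_local_T hx
  rw [mem_omegaSet, mem_omegaSet]
  have habs : ∀ t, |ε * t| = |t| := by rcases hε with rfl | rfl <;> simp
  have hεε : ε * ε = 1 := by rcases hε with rfl | rfl <;> simp
  constructor
  · intro H r hr M
    obtain ⟨n, hn, t, ht, heq⟩ := H (min r r₀) (lt_min hr hr₀) M
    refine ⟨n + 1, by omega, ε * t, ?_, ?_⟩
    · rw [habs]; exact ht.trans_le (min_le_left _ _)
    · rw [Function.iterate_succ_apply', heq, (h t (ht.trans_le (min_le_right _ _))).2]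
  · intro H r hr M
    obtain ⟨n, hn, t, ht, heq⟩ := H (min r r₀) (lt_min hr hr₀) (M + 1)
    obtain ⟨n, rfl⟩ := Nat.exists_eq_add_of_le' (show 1 ≤ n by omega)
    obtain ⟨h1, h2⟩ := h (ε * t) (by rw [habs]; exact ht.trans_le (min_le_right _ _))
    refine ⟨n, by omega, ε * t, ?_, T_injOn (iterate_mem_dom hz hO n) h1 ?_⟩
    · rw [habs]; exact ht.trans_le (min_le_left _ _)
    · rw [← Function.iterate_succ_apply' (f := L.T), heq, h2, ← mul_assoc, hεε, one_mul]

/-- The distance to the boundary of `I`. -/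
def bdist (L : LinearInvolution A) (x : ℝ × Bool) : ℝ := min (x.1 - L.lo) (L.hi - x.1)

lemma exists_pos_le_of_nonneg {ι : Type*} [Finite ι] {g : ι → ℝ} (hg : ∀ i, 0 ≤ g i) :
    ∃ δ > 0, ∀ i, g i = 0 ∨ 2 * δ ≤ g i := by
  have h : ∀ᶠ δ : ℝ in nhdsWithin 0 (Ioi 0), ∀ i, g i = 0 ∨ 2 * δ ≤ g i := by
    refine Filter.eventually_all.2 fun i => ?_
    rcases (hg i).eq_or_lt with h | h
    · exact .of_forall fun _ => .inl h.symm
    · filter_upwards [Ioo_mem_nhdsGT (half_pos h)] with δ hδ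
      exact .inr (by linarith [hδ.2])
  obtain ⟨δ, h1, h2⟩ := (h.and self_mem_nhdsWithin).exists
  exact ⟨δ, h2, h1⟩

lemma T_fst_eq {c : Letter A} {x : ℝ × Bool} (hx : x ∈ L.Ia c) :
    (L.T x).1 = L.endLo c.inv + (x.1 - L.endLo c) ∨
      (L.T x).1 = L.endHi c.inv - (x.1 - L.endLo c) := by
  have hlt := L.end_lt c
  have hlen := L.len_inv c
  have hT : (L.T x).1 = (L.s1 x).1 := rfl
  have hIa : ∀ t ∈ Ioo (L.endLo c) (L.endHi c), (t, L.comp c) ∈ L.Ia c := fun t ht =>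
    mem_Ia.2 ⟨ht, rfl⟩
  rcases L.s1_iso c with ⟨α, h⟩ | ⟨α, h⟩
  · left
    have hsub : Ioo (L.endLo c + α) (L.endHi c + α) ⊆ Ioo (L.endLo c.inv) (L.endHi c.inv) := by
      intro t ht
      have hm := hIa (t - α) ⟨by linarith [ht.1], by linarith [ht.2]⟩
      have := (mem_Ia.1 (s1_mem_Ia hm)).1
      rw [h _ hm] at this
      simpa using this
    obtain ⟨h1, h2⟩ := (Ioo_subset_Ioo_iff (by linarith)).1 hsub
    rw [hT, h x hx]
    dsimp only
    linarith
  · right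
    have hsub : Ioo (-L.endHi c + α) (-L.endLo c + α) ⊆
        Ioo (L.endLo c.inv) (L.endHi c.inv) := by
      intro t ht
      have hm := hIa (α - t) ⟨by linarith [ht.2], by linarith [ht.1]⟩
      have := (mem_Ia.1 (s1_mem_Ia hm)).1
      rw [h _ hm] at this
      simpa using this
    obtain ⟨h1, h2⟩ := (Ioo_subset_Ioo_iff (by linarith)).1 hsub
    rw [hT, h x hx]
    dsimp only
    linarith

/-- Near the boundary of `I`, the distance to the boundary is preserved by `T` as long as
the image stays near the boundary. -/
lemma exists_bdist_T_eq : ∃ δ > 0, ∀ x ∈ L.dom, L.bdist x < δ → L.bdist (L.T x) < δ →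
    L.bdist (L.T x) = L.bdist x := by
  have hlohi : ∀ c, L.endLo c < L.hi ∧ L.lo < L.endHi c := fun c =>
    ⟨(L.end_lt c).trans_le (L.sub_hi c), (L.sub_lo c).trans_lt (L.end_lt c)⟩
  obtain ⟨δ₁, h₁, hlo⟩ := exists_pos_le_of_nonneg fun c => sub_nonneg.2 (L.sub_lo c)
  obtain ⟨δ₂, h₂, hhi⟩ := exists_pos_le_of_nonneg fun c => sub_nonneg.2 (L.sub_hi c)
  obtain ⟨δ₃, h₃, hlo'⟩ := exists_pos_le_of_nonneg fun c => sub_nonneg.2 (hlohi c).1.le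
  obtain ⟨δ₄, h₄, hhi'⟩ := exists_pos_le_of_nonneg fun c => sub_nonneg.2 (hlohi c).2.le
  refine ⟨min (min δ₁ δ₂) (min δ₃ δ₄), lt_min (lt_min h₁ h₂) (lt_min h₃ h₄), ?_⟩
  intro x hx hxδ hTδ
  set δ := min (min δ₁ δ₂) (min δ₃ δ₄)
  have e₁ : δ ≤ δ₁ := (min_le_left _ _).trans (min_le_left _ _)
  have e₂ : δ ≤ δ₂ := (min_le_left _ _).trans (min_le_right _ _)
  have e₃ : δ ≤ δ₃ := (min_le_right _ _).trans (min_le_left _ _)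
  have e₄ : δ ≤ δ₄ := (min_le_right _ _).trans (min_le_right _ _)
  obtain ⟨c, hc⟩ := mem_dom.1 hx
  obtain ⟨hx1, hx2⟩ := (mem_Ia.1 hc).1
  have hlen := L.len_inv c
  have a₁ := hlo c
  have a₂ := hhi c
  have b₁ := hlo c.inv
  have b₂ := hhi c.inv
  have b₃ := (hlo' c.inv).resolve_left (by linarith [(hlohi c.inv).1])
  have b₄ := (hhi' c.inv).resolve_left (by linarith [(hlohi c.inv).2])
  have hT := T_fst_eq hc
  unfold bdist at *
  grind

lemma exists_mem_omegaSet (hnc : ¬ L.HasConnection) (hno : L.Nonorientable) {z : ℝ × Bool}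
    (hz : z ∈ L.Ihat) (hO : z ∉ L.O) : ∃ x ∈ L.Ihat, x ∈ L.omegaSet z := by
  obtain ⟨δ, hδ, h⟩ := L.exists_bdist_T_eq
  have hdom := iterate_mem_dom hz hO
  by_cases hfr : ∃ᶠ n in Filter.atTop, L.T^[n] z ∈ Icc (L.lo + δ) (L.hi - δ) ×ˢ (univ : Set Bool)
  · obtain ⟨x, hx, hcl⟩ :=
      (isCompact_Icc.prod isCompact_univ).exists_mapClusterPt_of_frequently hfr
    exact ⟨x, mem_Ihat.2 ⟨by linarith [hx.1.1], by linarith [hx.1.2]⟩, hcl⟩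
  · exfalso
    obtain ⟨N, hN⟩ := Filter.eventually_atTop.1 (Filter.not_frequently.1 hfr)
    have hlt : ∀ n ≥ N, L.bdist (L.T^[n] z) < δ := by
      intro n hn
      by_contra! hle
      obtain ⟨h1, h2⟩ := le_min_iff.1 hle
      exact hN n hn ⟨⟨by linarith, by linarith⟩, mem_univ _⟩
    have hconst : ∀ n, L.bdist (L.T^[n + N] z) = L.bdist (L.T^[N] z) := by
      intro n
      induction n with
      | zero => simp
      | succ n ih =>
        have h1 := hlt (n + N + 1) (by omega)
        rw [add_right_comm]
        rw [Function.iterate_succ_apply'] at h1 ⊢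
        rw [h _ (hdom _) (hlt _ (by omega)) h1, ih]
    set d := L.bdist (L.T^[N] z)
    have hmaps : MapsTo (fun n => L.T^[n + N] z) univ
        (({L.lo + d, L.hi - d} : Set ℝ) ×ˢ (univ : Set Bool)) := by
      intro n _
      refine ⟨?_, mem_univ _⟩
      have := hconst n
      rw [bdist] at this
      rcases min_choice ((L.T^[n + N] z).1 - L.lo) (L.hi - (L.T^[n + N] z).1) with h1 | h1
      · left; linarith
      · right
        show (L.T^[n + N] z).1 = _
        linarith
    obtain ⟨n, -, m, -, hne, heq⟩ := Set.Infinite.exists_ne_map_eq_of_mapsTo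
      (Set.infinite_univ (α := ℕ)) hmaps (Set.toFinite _)
    exact hne (by simpa using iterate_injective hnc hno hz hO heq)

lemma eventually_isCodingFrom {x : ℝ × Bool} {m : ℕ} {u : List (Letter A)}
    (hx : ∀ n, L.T^[n] x ∈ L.dom) (hu : L.IsCodingFrom x m u) :
    ∃ r > 0, ∀ t, |t| < r → L.IsCodingFrom (shift x t) m u := by
  have : ∀ᶠ y in nhds x, ∀ i : Fin u.length, L.T^[m + i.1] y ∈ L.Ia (u.get i) := by
    refine Filter.eventually_all.2 fun i => ?_
    obtain ⟨r, hr, ε, hε, h⟩ := exists_local_iterate (n := m + i.1) fun j _ => hx j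
    obtain ⟨r', hr', h'⟩ := mem_nhds_iff_shift.1 ((isOpen_Ia (u.get i)).mem_nhds (hu i))
    refine mem_nhds_iff_shift.2 ⟨min r r', lt_min hr hr', fun t ht => ?_⟩
    show L.T^[m + i.1] (shift x t) ∈ L.Ia (u.get i)
    rw [(h t (ht.trans_le (min_le_left _ _))).2]
    refine h' _ ?_
    have : |ε * t| = |t| := by rcases hε with rfl | rfl <;> simp
    rw [this]; exact ht.trans_le (min_le_right _ _)
  exact mem_nhds_iff_shift.1 this

end LinearInvolution

/-- For a nonorientable linear involution without connection,
`L(T)` equals the set of factors of `Σ_T(z)` for every `z ∈ Î ∖ Ô`. -/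
theorem stmt_5 {A : Type*} [Fintype A] (L : LinearInvolution A)
    (hnc : ¬ L.HasConnection) (hno : L.Nonorientable) :
    ∀ z ∈ L.Ihat \ L.Ohat,
      L.lang = {u : List (Letter A) | ∃ m : ℕ, L.IsCodingFrom z m u} := by
  rintro z hz
  have hO : z ∉ L.O := fun h => hz.2 (.inl h)
  refine Subset.antisymm ?_ fun u ⟨m, hm⟩ => ⟨z, hz, m, hm⟩
  rintro u ⟨y, hy, m, hm⟩
  have hyO : y ∉ L.O := fun h => hy.2 (.inl h)
  obtain ⟨r, hr, h⟩ :=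
    LinearInvolution.eventually_isCodingFrom (LinearInvolution.iterate_mem_dom hy.1 hyO) hm
  obtain ⟨x, hx, hxω⟩ := LinearInvolution.exists_mem_omegaSet hnc hno hz.1 hO
  have hyω := LinearInvolution.Ihat_subset_of_inv hnc hno
    (LinearInvolution.isClosed_omegaSet z) (LinearInvolution.inv_omegaSet hz.1 hO) hx hxω hy.1
  obtain ⟨n, -, t, ht, heq⟩ := LinearInvolution.mem_omegaSet.1 hyω r hr 0
  refine ⟨m + n, fun i => ?_⟩
  rw [add_right_comm, Function.iterate_add_apply, heq]
  exact h t ht i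

end LinInv
end
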